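/- Let n, r be positive integers and s a nonnegative integer. The number of weakly increasing tuples δ = (δ_1 ≤ δ_2 ≤ ... ≤ δ_{2n}) of integers in {0,1,...,r} satisfying Σ_{i=1}^{2n} (2i − 2n − 1)·δ_i = r·n² − s is at most the binomial coefficient C(s + 2n − 1, 2n − 1). -/

import Mathlib

open Finset

/-- The tuple `δ`, shifted by one and extended by `0` on the left and by `r` on the right. -/
def extendTuple {m r : ℕ} (δ : Fin m → Fin (r + 1)) : ℕ → ℕ
  | 0 => 0
  | j + 1 => if h : j < m then δ ⟨j, h⟩ else r

lemma extendTuple_zero {m r : ℕ} (δ : Fin m → Fin (r + 1)) : extendTuple δ 0 = 0 := rfl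

lemma extendTuple_succ_of_lt {m r : ℕ} (δ : Fin m → Fin (r + 1)) {j : ℕ} (h : j < m) :
    extendTuple δ (j + 1) = δ ⟨j, h⟩ := by
  simp [extendTuple, h]

lemma extendTuple_last {m r : ℕ} (δ : Fin m → Fin (r + 1)) : extendTuple δ (m + 1) = r := by
  simp [extendTuple]

lemma monotone_extendTuple {m r : ℕ} {δ : Fin m → Fin (r + 1)} (hδ : Monotone δ) :
    Monotone (extendTuple δ) := by
  refine monotone_nat_of_le_succ fun j => ?_
  cases j with
  | zero => simp [extendTuple_zero]
  | succ j =>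
    by_cases h : j + 1 < m
    · rw [extendTuple_succ_of_lt δ h, extendTuple_succ_of_lt δ (Nat.lt_of_succ_lt h)]
      exact hδ (Fin.mk_le_mk.2 j.le_succ)
    · simp only [extendTuple, h, dite_false]
      split_ifs
      · exact Nat.lt_succ_iff.1 (δ _).isLt
      · exact le_rfl

lemma sum_range_succ_diff_mul (D c : ℕ → ℤ) (m : ℕ) :
    ∑ j ∈ range (m + 1), (D (j + 1) - D j) * c j =
      D (m + 1) * c m - D 0 * c 0 - ∑ j ∈ range m, (c (j + 1) - c j) * D (j + 1) := by
  induction m with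
  | zero => simp; ring
  | succ m ih => rw [sum_range_succ, ih, sum_range_succ _ m]; ring

lemma sum_extendTuple_diff_mul_sq {n r : ℕ} (δ : Fin (2 * n) → Fin (r + 1)) :
    ∑ j ∈ range (2 * n + 1),
        ((extendTuple δ (j + 1) : ℤ) - extendTuple δ j) * ((n : ℤ) - j) ^ 2 =
      (r : ℤ) * n ^ 2 -
        ∑ i : Fin (2 * n), (2 * (((i : ℕ) : ℤ) + 1) - 2 * n - 1) * ((δ i : ℕ) : ℤ) := by
  rw [sum_range_succ_diff_mul (fun j => (extendTuple δ j : ℤ)) fun j => ((n : ℤ) - j) ^ 2,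
    extendTuple_last, extendTuple_zero, Finset.sum_range]
  simp only [extendTuple_succ_of_lt _ (Fin.isLt _)]
  congr 1
  · push_cast; ring
  · refine sum_congr rfl fun i _ => ?_
    push_cast; ring

/-- A function on `ℕ` is determined up to `m + 1` by its values at both ends and all but one of
its increments. -/
lemma eq_of_diff_eq_of_ne {D E : ℕ → ℤ} {m n : ℕ} (h0 : D 0 = E 0) (hm : D (m + 1) = E (m + 1))
    (h : ∀ j ≤ m, j ≠ n → D (j + 1) - D j = E (j + 1) - E j) {j : ℕ} (hj : j ≤ m + 1) :
    D j = E j := by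
  rcases le_or_gt j n with hjn | hjn
  · induction j with
    | zero => exact h0
    | succ j ih => linarith [ih (by omega) (by omega), h j (by omega) (by omega)]
  · induction hj using Nat.decreasingInduction with
    | self => exact hm
    | of_succ j hjm ih => linarith [ih (by omega), h j (by omega) (by omega)]

lemma card_piAntidiag_nat {ι : Type*} [DecidableEq ι] (t : Finset ι) (k : ℕ) :
    (t.piAntidiag k).card = (t.card + k - 1).choose k := by
  rw [← card_finsuppAntidiag_nat_eq_choose, finsuppAntidiag, card_map, card_attach]

open scoped Classical in
theorem card_delta_with_weighted_sum_le (n r s : ℕ) (hn : 0 < n) (hr : 0 < r) :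
    (Finset.univ.filter fun δ : Fin (2 * n) → Fin (r + 1) =>
        Monotone δ ∧
          ∑ i : Fin (2 * n), (2 * (((i : ℕ) : ℤ) + 1) - 2 * n - 1) * ((δ i : ℕ) : ℤ) =
            (r : ℤ) * n ^ 2 - s).card ≤
      (s + 2 * n - 1).choose (2 * n - 1) := by
  have hcard : (((range (2 * n + 1)).erase n).piAntidiag s).card =
      (s + 2 * n - 1).choose (2 * n - 1) := by
    rw [card_piAntidiag_nat, card_erase_of_mem (by simp; omega), card_range,
      ← Nat.choose_symm_of_eq_add (show s + 2 * n - 1 = s + (2 * n - 1) by omega)]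
    congr 1
    omega
  rw [← hcard]
  let w (δ : Fin (2 * n) → Fin (r + 1)) (j : ℕ) : ℤ :=
    ((extendTuple δ (j + 1) : ℤ) - extendTuple δ j) * ((n : ℤ) - j) ^ 2
  let f (δ : Fin (2 * n) → Fin (r + 1)) (j : ℕ) : ℕ :=
    if j ∈ (range (2 * n + 1)).erase n then (w δ j).toNat else 0
  have hw {δ : Fin (2 * n) → Fin (r + 1)} (hδ : Monotone δ) (j : ℕ) : 0 ≤ w δ j :=
    mul_nonneg (sub_nonneg.2 (mod_cast monotone_extendTuple hδ j.le_succ)) (sq_nonneg _)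
  refine card_le_card_of_injOn f (fun δ hδ => ?_) fun δ hδ ε hε hf => ?_
  · obtain ⟨hmono, hsum⟩ := (mem_filter.1 hδ).2
    refine mem_coe.2 (mem_piAntidiag.2 ⟨?_, fun j hj => ?_⟩)
    · zify
      calc ∑ j ∈ (range (2 * n + 1)).erase n, (f δ j : ℤ)
          = ∑ j ∈ (range (2 * n + 1)).erase n, w δ j :=
            sum_congr rfl fun j hj => by simp only [f, if_pos hj, Int.toNat_of_nonneg (hw hmono j)]
        _ = ∑ j ∈ range (2 * n + 1), w δ j := sum_erase _ (by simp [w])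
        _ = s := by rw [sum_extendTuple_diff_mul_sq, hsum]; ring
    · by_contra hj'
      exact hj (if_neg hj')
  · have hδm := (mem_filter.1 hδ).2.1
    have hεm := (mem_filter.1 hε).2.1
    have hdiff (j : ℕ) (hj : j ≤ 2 * n) (hjn : j ≠ n) :
        (extendTuple δ (j + 1) : ℤ) - extendTuple δ j =
          (extendTuple ε (j + 1) : ℤ) - extendTuple ε j := by
      have hmem : j ∈ (range (2 * n + 1)).erase n := by
        simp only [mem_erase, mem_range]; omega
      have h := congrFun hf j
      simp only [f, if_pos hmem] at h
      have hwj : w δ j = w ε j := by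
        rw [← Int.toNat_of_nonneg (hw hδm j), h, Int.toNat_of_nonneg (hw hεm j)]
      exact mul_right_cancel₀ (pow_ne_zero 2 (sub_ne_zero.2 (mod_cast hjn.symm))) hwj
    ext i
    have h := eq_of_diff_eq_of_ne (D := fun j => (extendTuple δ j : ℤ))
      (E := fun j => (extendTuple ε j : ℤ)) (m := 2 * n) (n := n) (by simp [extendTuple_zero])
      (by simp [extendTuple_last]) hdiff (j := i + 1) (by omega)
    simpa [extendTuple_succ_of_lt _ i.isLt] using h
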